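/- arXiv:2508.19802 — 5 statements merged into one kernel-verified Lean document; each statement's English description precedes it below -/
import Mathlib

section
/- Let Δ and Δ̄ be nonnegative integers. Then every extreme point of the wiggle-height polytope of an ordered storyline instance has all coordinates (all y_{t,c} and all w_{t,c}) integer. -/
open scoped Classical

noncomputable section

/-- An ordered storyline instance over a finite character type `C`. -/
structure Storyline (C : Type) [Fintype C] [DecidableEq C] where
  /-- the number `ℓ` of time steps; time steps are `1, …, len` -/
  len : ℕ
  len_pos : 0 < len
  /-- the set `A(c)` of time steps on which character `c` is active -/
  active : C → Finset ℕ
  active_nonempty : ∀ c, (active c).Nonempty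
  active_subset : ∀ c, active c ⊆ Finset.Icc 1 len
  /-- active time steps of a character are consecutive -/
  active_consec : ∀ c s t u, s ∈ active c → u ∈ active c → s ≤ t → t ≤ u → t ∈ active c
  /-- meetings, each given by its time step together with its set of characters -/
  meetings : Finset (ℕ × Finset C)
  meet_time : ∀ m ∈ meetings, m.1 ∈ Finset.Icc 1 len
  meet_active : ∀ m ∈ meetings, ∀ c ∈ m.2, m.1 ∈ active c
  /-- `pos t c` is the position of character `c` in the linear order `π_t` -/
  pos : ℕ → C → ℕ
  pos_injOn : ∀ t : ℕ, Set.InjOn (pos t) {c | t ∈ active c}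
  pos_lt : ∀ t c, t ∈ active c → pos t c < (Finset.univ.filter fun c' => t ∈ active c').card
  /-- the characters of each meeting appear consecutively in the order of its time step -/
  meet_consec : ∀ m ∈ meetings, ∀ c c'', c ∈ m.2 → c'' ∈ m.2 →
    ∀ c', m.1 ∈ active c' → pos m.1 c ≤ pos m.1 c' → pos m.1 c' ≤ pos m.1 c'' → c' ∈ m.2

namespace Storyline

variable {C : Type} [Fintype C] [DecidableEq C] (S : Storyline C)

/-- The set `T = {1, …, ℓ}` of time steps. -/
def T : Finset ℕ := Finset.Icc 1 S.len

/-- `Ac(t)`, the set of characters active at time step `t`. -/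
def Ac (t : ℕ) : Finset C := Finset.univ.filter fun c => t ∈ S.active c

/-- `c` and `c'` belong to a common meeting at time step `t`. -/
def SameMeeting (t : ℕ) (c c' : C) : Prop :=
  ∃ m ∈ S.meetings, m.1 = t ∧ c ∈ m.2 ∧ c' ∈ m.2

/-- `c` and `c'` are consecutive in `π_t` with `c ≺_t c'`. -/
def Consecutive (t : ℕ) (c c' : C) : Prop :=
  t ∈ S.active c ∧ t ∈ S.active c' ∧ S.pos t c' = S.pos t c + 1

/-- A coordination (`y t c` for `t ∈ A(c)`; other values are irrelevant) is valid if it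
respects all the orders `π_t`. -/
def Valid (y : ℕ → C → ℝ) : Prop :=
  ∀ t c c', t ∈ S.active c → t ∈ S.active c' → S.pos t c < S.pos t c' → y t c < y t c'

/-- A `(Δ, Δ̄)`-nice coordination. -/
def Nice (Δ Δbar : ℝ) (y : ℕ → C → ℝ) : Prop :=
  S.Valid y ∧
  ∀ t c c', S.Consecutive t c c' →
    (S.SameMeeting t c c' → |y t c' - y t c| = Δ) ∧
    (¬ S.SameMeeting t c c' → Δbar ≤ |y t c' - y t c|)

/-- A coordination is integral if all its (relevant) values are integers. -/
def Integral (y : ℕ → C → ℝ) : Prop :=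
  ∀ t c, t ∈ S.active c → ∃ z : ℤ, y t c = (z : ℝ)

/-- The total wiggle count `WC(y)`. -/
def WC (y : ℕ → C → ℝ) : ℕ :=
  Set.ncard {p : ℕ × C | 1 ≤ p.1 ∧ p.1 + 1 ≤ S.len ∧ p.1 ∈ S.active p.2 ∧
    p.1 + 1 ∈ S.active p.2 ∧ y p.1 p.2 ≠ y (p.1 + 1) p.2}

/-- The total linear wiggle height `LWH(y)`. -/
def LWH (y : ℕ → C → ℝ) : ℝ :=
  ∑ t ∈ Finset.Icc 1 (S.len - 1), ∑ c ∈ S.Ac t ∩ S.Ac (t + 1), |y t c - y (t + 1) c|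

/-- The total quadratic wiggle height `QWH(y)`. -/
def QWH (y : ℕ → C → ℝ) : ℝ :=
  ∑ t ∈ Finset.Icc 1 (S.len - 1), ∑ c ∈ S.Ac t ∩ S.Ac (t + 1), (y t c - y (t + 1) c) ^ 2

/-- Character `c` is wiggle-free in coordination `y`. -/
def WiggleFree (y : ℕ → C → ℝ) (c : C) : Prop :=
  ∀ t, t ∈ S.active c → t + 1 ∈ S.active c → y t c = y (t + 1) c

/-- Membership in the wiggle-height polytope (variables `y t c` for `t ∈ A(c)` and
`w t c` for `1 ≤ t ≤ ℓ - 1`, `c ∈ Ac(t) ∩ Ac(t+1)`; other values irrelevant). -/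
def InPolytope (Δ Δbar : ℝ) (y w : ℕ → C → ℝ) : Prop :=
  (∀ t c c', S.Consecutive t c c' → S.SameMeeting t c c' → y t c' - y t c = Δ) ∧
  (∀ t c c', S.Consecutive t c c' → ¬ S.SameMeeting t c c' → Δbar ≤ y t c' - y t c) ∧
  (∀ t c, 1 ≤ t → t + 1 ≤ S.len → t ∈ S.active c → t + 1 ∈ S.active c →
    y t c - y (t + 1) c ≤ w t c ∧ y (t + 1) c - y t c ≤ w t c) ∧
  (∀ t c, t ∈ S.active c → 0 ≤ y t c)

/-- `gap_t(c, c') = pos_t(c') - pos_t(c)` (as a real number). -/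
def gap (t : ℕ) (c c' : C) : ℝ := (S.pos t c' : ℝ) - (S.pos t c : ℝ)

/-- `Ccons_t(c, c')`: the number of positions `k` with `pos_t(c) ≤ k < pos_t(c')` such that
the characters at positions `k` and `k + 1` of `π_t` belong to a common meeting at `t`. -/
def Ccons (t : ℕ) (c c' : C) : ℕ :=
  Set.ncard {k : ℕ | S.pos t c ≤ k ∧ k < S.pos t c' ∧
    ∃ d d', t ∈ S.active d ∧ t ∈ S.active d' ∧ S.pos t d = k ∧ S.pos t d' = k + 1 ∧
      S.SameMeeting t d d'}

/-- `miny_t(c, c')`. -/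
def miny (Δ Δbar : ℝ) (t : ℕ) (c c' : C) : ℝ :=
  (S.Ccons t c c' : ℝ) * Δ + (S.gap t c c' - (S.Ccons t c c' : ℝ)) * Δbar

/-- `maxy_t(c, c')` (with value `+∞` when `c` and `c'` share no meeting at `t`). -/
def maxy (Δ : ℝ) (t : ℕ) (c c' : C) : EReal :=
  if S.SameMeeting t c c' then ((Δ * S.gap t c c' : ℝ) : EReal) else ⊤

end Storyline

namespace Storyline

variable {C : Type} [Fintype C] [DecidableEq C] (S : Storyline C)

/-- `(y, w)` is an extreme point of the wiggle-height polytope: it lies in the polytope and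
is not a proper convex combination of two other points of the polytope (equality of points is
taken on the relevant coordinates only). -/
def IsExtremePoint (Δ Δbar : ℝ) (y w : ℕ → C → ℝ) : Prop :=
  S.InPolytope Δ Δbar y w ∧
  ∀ y₁ w₁ y₂ w₂ (θ : ℝ), S.InPolytope Δ Δbar y₁ w₁ → S.InPolytope Δ Δbar y₂ w₂ →
    0 < θ → θ < 1 →
    (∀ t c, t ∈ S.active c → y t c = θ * y₁ t c + (1 - θ) * y₂ t c) →
    (∀ t c, 1 ≤ t → t + 1 ≤ S.len → t ∈ S.active c → t + 1 ∈ S.active c →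
      w t c = θ * w₁ t c + (1 - θ) * w₂ t c) →
    (∀ t c, t ∈ S.active c → y₁ t c = y₂ t c) ∧
    (∀ t c, 1 ≤ t → t + 1 ≤ S.len → t ∈ S.active c → t + 1 ∈ S.active c → w₁ t c = w₂ t c)

/-- Finitely many reals admit a common positive lower bound for the positive ones among them. -/
theorem exists_pos_le_of_pos {ι : Type*} [Finite ι] (g : ι → ℝ) :
    ∃ ε > 0, ∀ i, 0 < g i → ε ≤ g i := by
  have hev : ∀ᶠ ε in nhdsWithin (0 : ℝ) (Set.Ioi 0), ∀ i, 0 < g i → ε ≤ g i := by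
    refine Filter.eventually_all.2 fun i => ?_
    by_cases hi : 0 < g i
    · filter_upwards [Ioo_mem_nhdsGT hi] with ε hε _ using hε.2.le
    · exact Filter.Eventually.of_forall fun ε h => absurd h hi
  obtain ⟨ε, hε, hpos⟩ := (hev.and self_mem_nhdsWithin).exists
  exact ⟨ε, hpos, hε⟩

/-- Indicator of the entries of `y` whose fractional part is `f`. -/
def fractIndicator {D : Type*} (y : ℕ → D → ℝ) (f : ℝ) (t : ℕ) (c : D) : ℝ :=
  if Int.fract (y t c) = f then 1 else 0

theorem fractIndicator_congr {D : Type*} {y : ℕ → D → ℝ} {f : ℝ} {t t' : ℕ} {c c' : D} (z : ℤ)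
    (h : y t' c' - y t c = z) : fractIndicator y f t' c' = fractIndicator y f t c := by
  have hy : y t' c' = y t c + z := by linarith
  simp [fractIndicator, hy]

theorem fractIndicator_mem {D : Type*} (y : ℕ → D → ℝ) (f : ℝ) (t : ℕ) (c : D) :
    fractIndicator y f t c = 0 ∨ fractIndicator y f t c = 1 := by
  unfold fractIndicator
  split_ifs <;> simp

theorem abs_mul_fractIndicator_sub_le {D : Type*} (y : ℕ → D → ℝ) (f s : ℝ) (t t' : ℕ) (c c' : D) :
    |s * (fractIndicator y f t c - fractIndicator y f t' c')| ≤ |s| := by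
  rcases fractIndicator_mem y f t c with h | h <;>
    rcases fractIndicator_mem y f t' c' with h' | h' <;> simp [h, h']

theorem le_len_of_mem_active {t : ℕ} {c : C} (ht : t ∈ S.active c) : t ≤ S.len :=
  (Finset.mem_Icc.1 (S.active_subset c ht)).2

/-- Some `ε > 0` is at most every positive entry of `y`, every positive slack in the separation
inequalities and every nonzero wiggle height. -/
theorem exists_pos_le_slacks (Δbar : ℝ) (y : ℕ → C → ℝ) :
    ∃ ε > 0,
      (∀ t c, t ∈ S.active c → 0 < y t c → ε ≤ y t c) ∧
      (∀ t c c', t ∈ S.active c → 0 < y t c' - y t c - Δbar → ε ≤ y t c' - y t c - Δbar) ∧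
      (∀ t c, t ∈ S.active c → 0 < |y t c - y (t + 1) c| → ε ≤ |y t c - y (t + 1) c|) := by
  obtain ⟨ε₁, hε₁, h₁⟩ :=
    exists_pos_le_of_pos fun p : Fin (S.len + 1) × C => y p.1 p.2
  obtain ⟨ε₂, hε₂, h₂⟩ :=
    exists_pos_le_of_pos fun p : Fin (S.len + 1) × C × C => y p.1 p.2.2 - y p.1 p.2.1 - Δbar
  obtain ⟨ε₃, hε₃, h₃⟩ :=
    exists_pos_le_of_pos fun p : Fin (S.len + 1) × C => |y p.1 p.2 - y (p.1 + 1) p.2|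
  refine ⟨min ε₁ (min ε₂ ε₃), by positivity, fun t c ht h => ?_, fun t c c' ht h => ?_,
    fun t c ht h => ?_⟩
  · exact (min_le_left _ _).trans
      (h₁ (⟨t, Nat.lt_succ_of_le (S.le_len_of_mem_active ht)⟩, c) h)
  · exact ((min_le_right _ _).trans (min_le_left _ _)).trans
      (h₂ (⟨t, Nat.lt_succ_of_le (S.le_len_of_mem_active ht)⟩, c, c') h)
  · exact ((min_le_right _ _).trans (min_le_right _ _)).trans
      (h₃ (⟨t, Nat.lt_succ_of_le (S.le_len_of_mem_active ht)⟩, c) h)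

/-- Slightly shifting all entries of a common nonzero fractional part stays in the polytope. -/
theorem inPolytope_shift {Δ Δbar : ℕ} {y w : ℕ → C → ℝ} (h : S.InPolytope Δ Δbar y w)
    {f ε s : ℝ} (hf : f ≠ 0) (hs : |s| ≤ ε)
    (hy : ∀ t c, t ∈ S.active c → 0 < y t c → ε ≤ y t c)
    (hgap : ∀ t c c', t ∈ S.active c → 0 < y t c' - y t c - Δbar → ε ≤ y t c' - y t c - Δbar) :
    S.InPolytope Δ Δbar (fun t c => y t c + s * fractIndicator y f t c)
      (fun t c => |(y t c + s * fractIndicator y f t c) -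
        (y (t + 1) c + s * fractIndicator y f (t + 1) c)|) := by
  obtain ⟨hmeet, hsep, -, hnonneg⟩ := h
  refine ⟨fun t c c' hc hm => ?_, fun t c c' hc hm => ?_, fun t c _ _ _ _ => ?_,
    fun t c ht => ?_⟩
  · have := hmeet t c c' hc hm
    have hχ : fractIndicator y f t c' = fractIndicator y f t c :=
      fractIndicator_congr (Δ : ℤ) (by rw [this, Int.cast_natCast])
    simp only [hχ]
    linarith
  · rcases (hsep t c c' hc hm).eq_or_lt with heq | hlt
    · have hχ : fractIndicator y f t c' = fractIndicator y f t c :=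
        fractIndicator_congr (Δbar : ℤ) (by rw [← heq, Int.cast_natCast])
      simp only [hχ]
      linarith
    · have h₁ := hgap t c c' hc.1 (by linarith)
      have h₂ := neg_le_of_abs_le ((abs_mul_fractIndicator_sub_le y f s t t c' c).trans hs)
      linarith
  · exact ⟨le_abs_self _, (neg_sub _ _).ge.trans (neg_le_abs _)⟩
  · rcases (hnonneg t c ht).eq_or_lt with heq | hlt
    · simp [fractIndicator, ← heq, hf.symm]
    · have h₁ := hy t c ht hlt
      have h₂ := neg_le_of_abs_le hs
      rcases fractIndicator_mem y f t c with h | h <;> simp only [h] <;> linarith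

theorem abs_add_add_abs_sub_of_abs_le {d e : ℝ} (h : |e| ≤ |d|) :
    |d + e| + |d - e| = 2 * |d| := by
  have := abs_le.1 h
  rcases abs_cases d with hd | hd <;>
    rcases abs_cases (d + e) with h₁ | h₁ <;> rcases abs_cases (d - e) with h₂ | h₂ <;> linarith

/-- At an extreme point every wiggle variable equals the wiggle height it bounds. -/
theorem IsExtremePoint.wiggle_eq {S : Storyline C} {Δ Δbar : ℝ} {y w : ℕ → C → ℝ}
    (h : S.IsExtremePoint Δ Δbar y w) (t : ℕ) (c : C) (h1 : 1 ≤ t) (hlen : t + 1 ≤ S.len)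
    (ht : t ∈ S.active c) (ht' : t + 1 ∈ S.active c) : w t c = |y t c - y (t + 1) c| := by
  obtain ⟨⟨hmeet, hsep, hw, hnonneg⟩, hext⟩ := h
  have key := (hext y (fun t c => |y t c - y (t + 1) c|)
    y (fun t c => 2 * w t c - |y t c - y (t + 1) c|) (1 / 2)
    ⟨hmeet, hsep, fun t c _ _ _ _ =>
      ⟨le_abs_self _, (neg_sub _ _).ge.trans (neg_le_abs _)⟩, hnonneg⟩
    ⟨hmeet, hsep, fun t c h1 h2 h3 h4 => by
      have hwt := hw t c h1 h2 h3 h4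
      rcases abs_cases (y t c - y (t + 1) c) with h | h <;> constructor <;> linarith, hnonneg⟩
    (by norm_num) (by norm_num) (fun t c _ => by ring) (fun t c _ _ _ _ => by ring)).2
      t c h1 hlen ht ht'
  linarith

theorem IsExtremePoint.fract_eq_zero {S : Storyline C} {Δ Δbar : ℕ} {y w : ℕ → C → ℝ}
    (h : S.IsExtremePoint Δ Δbar y w) {t : ℕ} {c : C} (ht : t ∈ S.active c) :
    Int.fract (y t c) = 0 := by
  by_contra hf
  obtain ⟨ε, hε, hy, hgap, hwig⟩ := S.exists_pos_le_slacks Δbar y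
  have hε' : |ε| ≤ ε := (abs_of_pos hε).le
  have key := (h.2 _ _ _ _ (1 / 2) (S.inPolytope_shift h.1 hf hε' hy hgap)
    (S.inPolytope_shift h.1 hf (s := -ε) (by rwa [abs_neg]) hy hgap)
    (by norm_num) (by norm_num) (fun t c _ => by ring) (fun t' c' h1 hlen h3 h4 => ?_)).1 t c ht
  · simp only [fractIndicator, if_true] at key
    linarith
  · rw [h.wiggle_eq t' c' h1 hlen h3 h4]
    set χ := fractIndicator y (Int.fract (y t c)) with hχ
    have hle : |ε * (χ t' c' - χ (t' + 1) c')| ≤ |y t' c' - y (t' + 1) c'| := by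
      rcases (abs_nonneg (y t' c' - y (t' + 1) c')).eq_or_lt with h0 | h0
      · have hz : y t' c' - y (t' + 1) c' = ((0 : ℤ) : ℝ) := by
          rw [Int.cast_zero]
          exact abs_eq_zero.1 h0.symm
        simp [hχ, fractIndicator_congr 0 hz]
      · exact ((abs_mul_fractIndicator_sub_le ..).trans hε').trans (hwig t' c' h3 h0)
    have hsum := abs_add_add_abs_sub_of_abs_le hle
    have e₁ : y t' c' + ε * χ t' c' - (y (t' + 1) c' + ε * χ (t' + 1) c') =
        y t' c' - y (t' + 1) c' + ε * (χ t' c' - χ (t' + 1) c') := by ring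
    have e₂ : y t' c' + -ε * χ t' c' - (y (t' + 1) c' + -ε * χ (t' + 1) c') =
        y t' c' - y (t' + 1) c' - ε * (χ t' c' - χ (t' + 1) c') := by ring
    rw [e₁, e₂]
    linarith

/-- If `Δ, Δ̄` are nonnegative integers, then every extreme point of the wiggle-height
polytope has all (relevant) coordinates integer. -/
theorem extremePoint_integer (Δ Δbar : ℕ) (y w : ℕ → C → ℝ)
    (h : S.IsExtremePoint (Δ : ℝ) (Δbar : ℝ) y w) :
    (∀ t c, t ∈ S.active c → ∃ z : ℤ, y t c = (z : ℝ)) ∧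
    (∀ t c, 1 ≤ t → t + 1 ≤ S.len → t ∈ S.active c → t + 1 ∈ S.active c →
      ∃ z : ℤ, w t c = (z : ℝ)) := by
  have hint : ∀ t c, t ∈ S.active c → ∃ z : ℤ, y t c = (z : ℝ) := fun t c ht =>
    ⟨⌊y t c⌋, by have := Int.floor_add_fract (y t c); rw [h.fract_eq_zero ht] at this; linarith⟩
  refine ⟨hint, fun t c h1 hlen ht ht' => ?_⟩
  obtain ⟨a, ha⟩ := hint t c ht
  obtain ⟨b, hb⟩ := hint (t + 1) c ht'
  exact ⟨|a - b|, by rw [h.wiggle_eq t c h1 hlen ht ht', ha, hb]; push_cast; rfl⟩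

end Storyline
end
end

section
/- Let Δ and Δ̄ be positive integers. For each natural number k, if there exists a (Δ,Δ̄)-nice coordination y with WC(y) = k, then there exists an integral (Δ,Δ̄)-nice coordination y′ with WC(y′) ≤ k. -/
open scoped Classical

noncomputable section

namespace Storyline

/-- Every position below that of an active character is occupied by an active character. -/
theorem exists_pos_eq {C : Type} [Fintype C] [DecidableEq C] (S : Storyline C) {t n : ℕ} {c : C}
    (hc : t ∈ S.active c) (hn : n ≤ S.pos t c) : ∃ d, t ∈ S.active d ∧ S.pos t d = n := by
  have himage : (S.Ac t).image (S.pos t) = Finset.range (S.Ac t).card := by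
    apply Finset.eq_of_subset_of_card_le
    · intro k hk
      obtain ⟨d, hd, rfl⟩ := Finset.mem_image.1 hk
      exact Finset.mem_range.2 (S.pos_lt t d (Finset.mem_filter.1 hd).2)
    · rw [Finset.card_range, Finset.card_image_of_injOn]
      exact (S.pos_injOn t).mono fun d hd => (Finset.mem_filter.1 hd).2
  have hmem : n ∈ (S.Ac t).image (S.pos t) := by
    rw [himage]
    exact Finset.mem_range.2 (hn.trans_lt (S.pos_lt t c hc))
  obtain ⟨d, hd, rfl⟩ := Finset.mem_image.1 hmem
  exact ⟨d, (Finset.mem_filter.1 hd).2, rfl⟩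

/-- Rounding down preserves niceness for positive integer distances. -/
theorem Nice.floor {C : Type} [Fintype C] [DecidableEq C] {S : Storyline C}
    {Δ Δbar : ℕ} (hΔ : 0 < Δ) (hΔbar : 0 < Δbar) {y : ℕ → C → ℝ}
    (hy : S.Nice (Δ : ℝ) (Δbar : ℝ) y) :
    S.Nice (Δ : ℝ) (Δbar : ℝ) fun t c => (⌊y t c⌋ : ℝ) := by
  obtain ⟨hvalid, hdist⟩ := hy
  have hmeet : ∀ t c c', S.Consecutive t c c' → S.SameMeeting t c c' →
      ⌊y t c'⌋ = ⌊y t c⌋ + Δ := by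
    intro t c c' h hm
    have hlt := hvalid t c c' h.1 h.2.1 (by have := h.2.2; omega)
    have heq := (hdist t c c' h).1 hm
    rw [abs_of_pos (sub_pos.2 hlt)] at heq
    rw [← Int.floor_add_natCast]
    congr 1
    linarith
  have hsep : ∀ t c c', S.Consecutive t c c' → ¬ S.SameMeeting t c c' →
      ⌊y t c⌋ + Δbar ≤ ⌊y t c'⌋ := by
    intro t c c' h hm
    have hlt := hvalid t c c' h.1 h.2.1 (by have := h.2.2; omega)
    have hle := (hdist t c c' h).2 hm
    rw [abs_of_pos (sub_pos.2 hlt)] at hle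
    rw [← Int.floor_add_natCast]
    exact Int.floor_le_floor (by linarith)
  refine ⟨fun t c c' hc hc' hpos => ?_, fun t c c' h => ⟨fun hm => ?_, fun hm => ?_⟩⟩
  · obtain ⟨d, hd, hdpos⟩ := S.exists_pos_eq hc' (n := S.pos t c + 1) hpos
    have hcd : ⌊y t c⌋ < ⌊y t d⌋ := by
      by_cases hm : S.SameMeeting t c d
      · have := hmeet t c d ⟨hc, hd, hdpos⟩ hm
        omega
      · have := hsep t c d ⟨hc, hd, hdpos⟩ hm
        omega
    have hdc' : y t d ≤ y t c' := by
      rcases (show S.pos t d ≤ S.pos t c' by omega).lt_or_eq with hlt | heq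
      · exact (hvalid t d c' hd hc' hlt).le
      · rw [S.pos_injOn t hd hc' heq]
    exact Int.cast_lt.2 (hcd.trans_le (Int.floor_le_floor hdc'))
  · simp [hmeet t c c' h hm]
  · have hle : ((⌊y t c⌋ + Δbar : ℤ) : ℝ) ≤ ⌊y t c'⌋ := Int.cast_le.2 (hsep t c c' h hm)
    push_cast at hle
    exact le_abs.2 (Or.inl (by linarith))

/-- Applying a function to all values does not increase the wiggle count. -/
theorem WC_comp_le {C : Type} [Fintype C] [DecidableEq C] (S : Storyline C)
    (f : ℝ → ℝ) (y : ℕ → C → ℝ) : S.WC (fun t c => f (y t c)) ≤ S.WC y := by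
  refine Set.ncard_le_ncard ?_ ?_
  · rintro p ⟨h₁, h₂, h₃, h₄, hne⟩
    exact ⟨h₁, h₂, h₃, h₄, fun heq => hne (congrArg f heq)⟩
  · refine ((Set.finite_Iic S.len).prod (Set.finite_univ (α := C))).subset ?_
    rintro p ⟨-, h, -⟩
    exact ⟨(Nat.le_succ _).trans h, Set.mem_univ _⟩

/-- For positive integers `Δ, Δ̄`: if there is a `(Δ, Δ̄)`-nice coordination with `k` wiggles,
then there is an integral one with at most `k` wiggles. -/
theorem exists_integral_of_wc {C : Type} [Fintype C] [DecidableEq C] (S : Storyline C)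
    (Δ Δbar : ℕ) (hΔ : 0 < Δ) (hΔbar : 0 < Δbar) (k : ℕ)
    (h : ∃ y, S.Nice (Δ : ℝ) (Δbar : ℝ) y ∧ S.WC y = k) :
    ∃ y', S.Nice (Δ : ℝ) (Δbar : ℝ) y' ∧ S.Integral y' ∧ S.WC y' ≤ k := by
  obtain ⟨y, hy, rfl⟩ := h
  exact ⟨_, hy.floor hΔ hΔbar, fun _ _ _ => ⟨_, rfl⟩, S.WC_comp_le (fun x => (⌊x⌋ : ℝ)) y⟩

end Storyline
end
end

section
/- For any ordered storyline instance, the minimum of WC(y) over all valid integral coordinations y equals Σ_{t=1}^{ℓ−1} (|Ac(t) ∩ Ac(t+1)| − L_t), where L_t denotes the maximum length of a sequence of distinct characters of Ac(t) ∩ Ac(t+1) that is increasing with respect to both ≺_t and ≺_{t+1} (i.e., the length of a longest common subsequence of π_t and π_{t+1} restricted to Ac(t) ∩ Ac(t+1)). -/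
open scoped Classical

noncomputable section

namespace Storyline

variable {C : Type} [Fintype C] [DecidableEq C] (S : Storyline C)

/-- `L_t`: the maximum length of a sequence of distinct characters of `Ac(t) ∩ Ac(t+1)` that is
increasing with respect to both `≺_t` and `≺_{t+1}` (longest common subsequence of `π_t` and
`π_{t+1}` restricted to `Ac(t) ∩ Ac(t+1)`). -/
noncomputable def lcsLen (t : ℕ) : ℕ :=
  sSup {m : ℕ | ∃ f : Fin m → C,
    (∀ i, t ∈ S.active (f i) ∧ t + 1 ∈ S.active (f i)) ∧
    (∀ i j : Fin m, i < j →
      S.pos t (f i) < S.pos t (f j) ∧ S.pos (t + 1) (f i) < S.pos (t + 1) (f j))}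

/-- A real function that is strictly increasing on a finite set `K` can be changed off `K` so as to
be strictly increasing on a larger finite set. -/
lemma exists_strictMonoOn_union {α : Type*} [LinearOrder α] (K B : Finset α) (u : α → ℝ)
    (hu : StrictMonoOn u K) :
    ∃ g : α → ℝ, StrictMonoOn g (K ∪ B : Finset α) ∧ ∀ k ∈ K, g k = u k := by
  induction B using Finset.induction_on with
  | empty => exact ⟨u, by simpa using hu, fun _ _ => rfl⟩
  | insert b B _ ih =>
    obtain ⟨g, hg, hgu⟩ := ih
    by_cases hb : b ∈ K ∪ B
    · refine ⟨g, ?_, hgu⟩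
      rwa [Finset.union_insert, Finset.insert_eq_of_mem hb]
    obtain ⟨m, hlo, hhi⟩ := Order.exists_between_finsets
      (((K ∪ B).filter (· < b)).image g) (((K ∪ B).filter (b < ·)).image g) (by
        intro x hx z hz
        obtain ⟨i, hi, rfl⟩ := Finset.mem_image.1 hx
        obtain ⟨j, hj, rfl⟩ := Finset.mem_image.1 hz
        rw [Finset.mem_filter] at hi hj
        exact hg hi.1 hj.1 (hi.2.trans hj.2))
    refine ⟨Function.update g b m, ?_, fun k hk => ?_⟩
    · intro i hi j hj hij
      rw [Finset.union_insert, Finset.mem_coe, Finset.mem_insert] at hi hj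
      rcases hi with rfl | hi <;> rcases hj with rfl | hj
      · exact absurd hij (lt_irrefl _)
      · rw [Function.update_self, Function.update_of_ne hij.ne']
        exact hhi _ (Finset.mem_image_of_mem _ (Finset.mem_filter.2 ⟨hj, hij⟩))
      · rw [Function.update_self, Function.update_of_ne hij.ne]
        exact hlo _ (Finset.mem_image_of_mem _ (Finset.mem_filter.2 ⟨hi, hij⟩))
      · rw [Function.update_of_ne (ne_of_mem_of_not_mem hi hb),
          Function.update_of_ne (ne_of_mem_of_not_mem hj hb)]
        exact hg hi hj hij
    · rw [Function.update_of_ne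
        (ne_of_mem_of_not_mem (Finset.mem_union_left B hk) hb), hgu k hk]

/-- `K` is the set of characters of a common subsequence of `π_t` and `π_{t+1}`. -/
def IsCommonSubseq (t : ℕ) (K : Finset C) : Prop :=
  K ⊆ S.Ac t ∩ S.Ac (t + 1) ∧
    ∀ c ∈ K, ∀ c' ∈ K, S.pos t c < S.pos t c' → S.pos (t + 1) c < S.pos (t + 1) c'

lemma mem_Ac {t : ℕ} {c : C} : c ∈ S.Ac t ↔ t ∈ S.active c := by
  simp [Ac]

lemma injective_of_increasing {t m : ℕ} {f : Fin m → C}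
    (hf : ∀ i j : Fin m, i < j →
      S.pos t (f i) < S.pos t (f j) ∧ S.pos (t + 1) (f i) < S.pos (t + 1) (f j)) :
    Function.Injective f := by
  have h : StrictMono (S.pos t ∘ f) := fun i j hij => (hf i j hij).1
  exact h.injective.of_comp

lemma bddAbove_lcs (t : ℕ) : BddAbove {m : ℕ | ∃ f : Fin m → C,
    (∀ i, t ∈ S.active (f i) ∧ t + 1 ∈ S.active (f i)) ∧
    (∀ i j : Fin m, i < j →
      S.pos t (f i) < S.pos t (f j) ∧ S.pos (t + 1) (f i) < S.pos (t + 1) (f j))} := by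
  refine ⟨Fintype.card C, ?_⟩
  rintro m ⟨f, -, hf⟩
  simpa using Fintype.card_le_of_injective f (S.injective_of_increasing hf)

lemma exists_isCommonSubseq_card_eq_lcsLen (t : ℕ) :
    ∃ K, S.IsCommonSubseq t K ∧ K.card = S.lcsLen t := by
  obtain ⟨f, hact, hf⟩ := Nat.sSup_mem
    (by exact ⟨0, Fin.elim0, fun i => i.elim0, fun i => i.elim0⟩) (S.bddAbove_lcs t)
  refine ⟨Finset.univ.image f, ⟨?_, ?_⟩, ?_⟩
  · intro c hc
    obtain ⟨i, -, rfl⟩ := Finset.mem_image.1 hc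
    simpa [mem_Ac] using hact i
  · intro c hc c' hc' hlt
    obtain ⟨i, -, rfl⟩ := Finset.mem_image.1 hc
    obtain ⟨j, -, rfl⟩ := Finset.mem_image.1 hc'
    rcases lt_trichotomy i j with h | rfl | h
    · exact (hf i j h).2
    · exact absurd hlt (lt_irrefl _)
    · exact absurd hlt (hf j i h).1.not_gt
  · rw [Finset.card_image_of_injective _ (S.injective_of_increasing hf), Finset.card_univ,
      Fintype.card_fin]
    rfl

lemma IsCommonSubseq.card_le_lcsLen {S : Storyline C} {t : ℕ} {K : Finset C}
    (hK : S.IsCommonSubseq t K) : K.card ≤ S.lcsLen t := by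
  have hact : ∀ c ∈ K, t ∈ S.active c ∧ t + 1 ∈ S.active c := fun c hc => by
    simpa [mem_Ac] using hK.1 hc
  have hinj : Set.InjOn (S.pos t) K := (S.pos_injOn t).mono fun c hc => (hact c hc).1
  have hcard : (K.image (S.pos t)).card = K.card := Finset.card_image_of_injOn hinj
  have hex : ∀ i, ∃ c ∈ K, S.pos t c = (K.image (S.pos t)).orderEmbOfFin hcard i := fun i =>
    Finset.mem_image.1 (Finset.orderEmbOfFin_mem _ hcard i)
  choose f hfK hf using hex
  refine le_csSup (S.bddAbove_lcs t) ⟨f, fun i => hact _ (hfK i), fun i j hij => ?_⟩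
  have h : S.pos t (f i) < S.pos t (f j) := by
    rw [hf, hf]
    exact (OrderEmbedding.strictMono _) hij
  exact ⟨h, hK.2 _ (hfK i) _ (hfK j) h⟩

lemma WC_eq_sum (y : ℕ → C → ℝ) :
    S.WC y = ∑ t ∈ Finset.Icc 1 (S.len - 1),
      ((S.Ac t ∩ S.Ac (t + 1)).filter fun c => y t c ≠ y (t + 1) c).card := by
  rw [← Finset.card_sigma, WC, ← Set.ncard_coe_finset]
  refine Set.ncard_congr (fun p _ => ⟨p.1, p.2⟩) ?_ ?_ ?_
  · rintro ⟨t, c⟩ ⟨h1, h2, h3, h4, h5⟩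
    simp only [Finset.mem_coe, Finset.mem_sigma, Finset.mem_Icc, Finset.mem_filter,
      Finset.mem_inter, mem_Ac]
    dsimp only at *
    exact ⟨⟨h1, by omega⟩, ⟨h3, h4⟩, h5⟩
  · rintro ⟨t, c⟩ ⟨t', c'⟩ - - h
    simpa using h
  · rintro ⟨t, c⟩ h
    simp only [Finset.mem_coe, Finset.mem_sigma, Finset.mem_Icc, Finset.mem_filter,
      Finset.mem_inter, mem_Ac] at h
    obtain ⟨⟨h1, h2⟩, ⟨h3, h4⟩, h5⟩ := h
    have := S.len_pos
    exact ⟨(t, c), ⟨h1, by dsimp only; omega, h3, h4, h5⟩, rfl⟩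

/-- The characters without a wiggle between `t` and `t + 1` form a common subsequence. -/
lemma Valid.isCommonSubseq {S : Storyline C} {y : ℕ → C → ℝ} (hy : S.Valid y) (t : ℕ) :
    S.IsCommonSubseq t ((S.Ac t ∩ S.Ac (t + 1)).filter fun c => y t c = y (t + 1) c) := by
  refine ⟨Finset.filter_subset _ _, fun c hc c' hc' hlt => ?_⟩
  simp only [Finset.mem_filter, Finset.mem_inter, mem_Ac] at hc hc'
  obtain ⟨⟨hc, hc₁⟩, hceq⟩ := hc
  obtain ⟨⟨hc', hc₁'⟩, hceq'⟩ := hc'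
  have hy₁ := hy t c c' hc hc' hlt
  rw [hceq, hceq'] at hy₁
  rcases lt_trichotomy (S.pos (t + 1) c) (S.pos (t + 1) c') with h | h | h
  · exact h
  · rw [S.pos_injOn (t + 1) hc₁ hc₁' h] at hlt
    exact absurd hlt (lt_irrefl _)
  · exact absurd hy₁ (hy (t + 1) c' c hc₁' hc₁ h).not_gt

lemma Valid.sum_le_WC {S : Storyline C} {y : ℕ → C → ℝ} (hy : S.Valid y) :
    ∑ t ∈ Finset.Icc 1 (S.len - 1), ((S.Ac t ∩ S.Ac (t + 1)).card - S.lcsLen t) ≤ S.WC y := by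
  rw [WC_eq_sum]
  refine Finset.sum_le_sum fun t _ => ?_
  have h₁ := (hy.isCommonSubseq t).card_le_lcsLen
  have h₂ := Finset.card_filter_add_card_filter_not (s := S.Ac t ∩ S.Ac (t + 1))
    (fun c => y t c = y (t + 1) c)
  simp only [ne_eq]
  omega

/-- A valid assignment of coordinates at `t` extends to `t + 1` without moving the characters of a
common subsequence. -/
lemma IsCommonSubseq.exists_next {S : Storyline C} {t : ℕ} {K : Finset C}
    (hK : S.IsCommonSubseq t K) (v : C → ℝ)
    (hv : ∀ c c', t ∈ S.active c → t ∈ S.active c' → S.pos t c < S.pos t c' → v c < v c') :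
    ∃ w : C → ℝ, (∀ c c', t + 1 ∈ S.active c → t + 1 ∈ S.active c' →
      S.pos (t + 1) c < S.pos (t + 1) c' → w c < w c') ∧ ∀ c ∈ K, w c = v c := by
  have hact : ∀ c ∈ K, t ∈ S.active c ∧ t + 1 ∈ S.active c := fun c hc => by
    simpa [mem_Ac] using hK.1 hc
  have hinj : Set.InjOn (S.pos (t + 1)) K := (S.pos_injOn (t + 1)).mono fun c hc => (hact c hc).2
  have hu : ∃ u : ℕ → ℝ, ∀ c ∈ K, u (S.pos (t + 1) c) = v c := by
    rcases isEmpty_or_nonempty C with hC | hC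
    · exact ⟨0, fun c => isEmptyElim c⟩
    · refine ⟨fun n => v (Function.invFunOn (S.pos (t + 1)) K n), fun c hc => ?_⟩
      exact congrArg v (hinj.leftInvOn_invFunOn hc)
  obtain ⟨u, hu⟩ := hu
  obtain ⟨g, hg, hgu⟩ := exists_strictMonoOn_union (K.image (S.pos (t + 1)))
    (Finset.univ.image (S.pos (t + 1))) u (by
      intro a ha b hb hab
      obtain ⟨c, hc, rfl⟩ := Finset.mem_image.1 ha
      obtain ⟨c', hc', rfl⟩ := Finset.mem_image.1 hb
      rw [hu c hc, hu c' hc']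
      rcases lt_trichotomy (S.pos t c) (S.pos t c') with h | h | h
      · exact hv c c' (hact c hc).1 (hact c' hc').1 h
      · rw [S.pos_injOn t (hact c hc).1 (hact c' hc').1 h] at hab
        exact absurd hab (lt_irrefl _)
      · exact absurd hab (hK.2 c' hc' c hc h).not_gt)
  refine ⟨fun c => g (S.pos (t + 1) c), fun c c' _ _ h => hg ?_ ?_ h, fun c hc => ?_⟩
  · exact Finset.mem_union_right _ (Finset.mem_image_of_mem _ (Finset.mem_univ c))
  · exact Finset.mem_union_right _ (Finset.mem_image_of_mem _ (Finset.mem_univ c'))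
  · exact (hgu _ (Finset.mem_image_of_mem _ hc)).trans (hu c hc)

lemma exists_valid_of_isCommonSubseq (K : ℕ → Finset C) (hK : ∀ t, S.IsCommonSubseq t (K t)) :
    ∃ y : ℕ → C → ℝ, S.Valid y ∧ ∀ t, ∀ c ∈ K t, y (t + 1) c = y t c := by
  choose next hvalid hkeep using fun t => (hK t).exists_next
  let y : ∀ t, {v : C → ℝ // ∀ c c', t ∈ S.active c → t ∈ S.active c' →
      S.pos t c < S.pos t c' → v c < v c'} := fun t =>
    Nat.rec ⟨fun c => S.pos 0 c, fun _ _ _ _ h => Nat.cast_lt.2 h⟩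
      (fun t v => ⟨next t v.1 v.2, hvalid t v.1 v.2⟩) t
  exact ⟨fun t => (y t).1, fun t => (y t).2, fun t => hkeep t (y t).1 (y t).2⟩

/-- The values of a valid coordination can be made integral without creating new wiggles. -/
lemma Valid.exists_integral {S : Storyline C} {y : ℕ → C → ℝ} (hy : S.Valid y) :
    ∃ z, S.Valid z ∧ S.Integral z ∧
      ∀ t t' c, y t c = y t' c → z t c = z t' c := by
  let V : Finset ℝ := (Finset.Icc 1 S.len ×ˢ (Finset.univ : Finset C)).image fun p => y p.1 p.2
  refine ⟨fun t c => ((V.filter (· < y t c)).card : ℕ), fun t c c' hc hc' h => ?_,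
    fun t c _ => ⟨(V.filter (· < y t c)).card, by simp⟩, fun t t' c h => by simp only [h]⟩
  have hlt := hy t c c' hc hc' h
  have hmem : y t c ∈ V := Finset.mem_image.2
    ⟨(t, c), Finset.mem_product.2 ⟨S.active_subset c hc, Finset.mem_univ c⟩, rfl⟩
  refine Nat.cast_lt.2 (Finset.card_lt_card (Finset.ssubset_iff_of_subset ?_ |>.2 ⟨y t c, ?_, ?_⟩))
  · exact Finset.monotone_filter_right _ fun x _ hx => lt_trans hx hlt
  · exact Finset.mem_filter.2 ⟨hmem, hlt⟩
  · simp

lemma exists_valid_integral_WC_le :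
    ∃ y, S.Valid y ∧ S.Integral y ∧ S.WC y ≤
      ∑ t ∈ Finset.Icc 1 (S.len - 1), ((S.Ac t ∩ S.Ac (t + 1)).card - S.lcsLen t) := by
  choose K hK hcard using S.exists_isCommonSubseq_card_eq_lcsLen
  obtain ⟨y, hy, hkeep⟩ := S.exists_valid_of_isCommonSubseq K hK
  obtain ⟨z, hz, hint, hzy⟩ := hy.exists_integral
  refine ⟨z, hz, hint, ?_⟩
  rw [WC_eq_sum]
  refine Finset.sum_le_sum fun t _ => ?_
  rw [← hcard, ← Finset.card_sdiff_of_subset (hK t).1]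
  refine Finset.card_le_card fun c hc => ?_
  rw [Finset.mem_filter] at hc
  exact Finset.mem_sdiff.2 ⟨hc.1, fun hcK => hc.2 (hzy _ _ _ (hkeep t c hcK).symm)⟩

/-- The minimum wiggle count over all valid integral coordinations equals
`Σ_{t=1}^{ℓ-1} (|Ac(t) ∩ Ac(t+1)| - L_t)`. -/
theorem wcMin_valid_integral_eq :
    sInf {n : ℕ | ∃ y, S.Valid y ∧ S.Integral y ∧ S.WC y = n} =
      ∑ t ∈ Finset.Icc 1 (S.len - 1), ((S.Ac t ∩ S.Ac (t + 1)).card - S.lcsLen t) := by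
  obtain ⟨y, hy, hint, hle⟩ := S.exists_valid_integral_WC_le
  refine le_antisymm (le_trans (Nat.sInf_le ⟨y, hy, hint, rfl⟩) hle) ?_
  refine le_csInf ⟨_, y, hy, hint, rfl⟩ ?_
  rintro n ⟨z, hz, -, rfl⟩
  exact hz.sum_le_WC

end Storyline
end
end

section
/- Let Δ > 0 and Δ̄ > 0 be real numbers. Then the minimum of Σ_{t=1}^{ℓ−1} Σ_{c ∈ Ac(t) ∩ Ac(t+1)} w_{t,c} over all points of the wiggle-height polytope is attained and equals the minimum of LWH(y) over all (Δ,Δ̄)-nice coordinations y, which is also attained. -/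
open scoped Classical

noncomputable section

namespace Storyline

variable {C : Type} [Fintype C] [DecidableEq C] (S : Storyline C)

/-- The LP objective `Σ_t Σ_c w_{t,c}`. -/
noncomputable def sumW (w : ℕ → C → ℝ) : ℝ :=
  ∑ t ∈ Finset.Icc 1 (S.len - 1), ∑ c ∈ S.Ac t ∩ S.Ac (t + 1), w t c

/-- The separation constraints between consecutive characters, without absolute values. -/
def Separated (Δ Δbar : ℝ) (y : ℕ → C → ℝ) : Prop :=
  (∀ t c c', S.Consecutive t c c' → S.SameMeeting t c c' → y t c' - y t c = Δ) ∧
  (∀ t c c', S.Consecutive t c c' → ¬ S.SameMeeting t c c' → Δbar ≤ y t c' - y t c)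

theorem exists_pos_eq_s7 {t k : ℕ} (hk : k < (S.Ac t).card) :
    ∃ c, t ∈ S.active c ∧ S.pos t c = k := by
  have hsurj : Set.SurjOn (S.pos t) (S.Ac t) (Finset.range (S.Ac t).card) := by
    apply Finset.surjOn_of_injOn_of_card_le
    · intro c hc
      have hc' : t ∈ S.active c := by simpa [Ac] using hc
      exact Finset.mem_coe.2 (Finset.mem_range.2 (S.pos_lt t c hc'))
    · intro c hc d hd h
      exact S.pos_injOn t (by simpa [Ac] using hc) (by simpa [Ac] using hd) h
    · simp
  obtain ⟨c, hc, h⟩ := hsurj (by simpa using hk)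
  exact ⟨c, by simpa [Ac] using hc, h⟩

variable {S} in
theorem Separated.lt_of_consecutive {Δ Δbar : ℝ} (hΔ : 0 < Δ) (hΔbar : 0 < Δbar)
    {y : ℕ → C → ℝ} (h : S.Separated Δ Δbar y) {t : ℕ} {c c' : C}
    (hc : S.Consecutive t c c') : y t c < y t c' := by
  by_cases hm : S.SameMeeting t c c'
  · linarith [h.1 t c c' hc hm]
  · linarith [h.2 t c c' hc hm]

variable {S} in
theorem Separated.valid {Δ Δbar : ℝ} (hΔ : 0 < Δ) (hΔbar : 0 < Δbar)
    {y : ℕ → C → ℝ} (h : S.Separated Δ Δbar y) : S.Valid y := by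
  suffices H : ∀ n t c c', t ∈ S.active c → t ∈ S.active c' →
      S.pos t c' = S.pos t c + 1 + n → y t c < y t c' by
    intro t c c' hc hc' hlt
    exact H (S.pos t c' - (S.pos t c + 1)) t c c' hc hc' (by omega)
  intro n
  induction n with
  | zero => exact fun t c c' hc hc' hn => h.lt_of_consecutive hΔ hΔbar ⟨hc, hc', hn⟩
  | succ n ih =>
    intro t c c' hc hc' hn
    have hlt : S.pos t c' < (S.Ac t).card := S.pos_lt t c' hc'
    obtain ⟨d, hd, hdpos⟩ := S.exists_pos_eq_s7 (t := t) (k := S.pos t c + 1 + n) (by omega)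
    exact (ih t c d hc hd hdpos).trans
      (h.lt_of_consecutive hΔ hΔbar ⟨hd, hc', by omega⟩)

theorem nice_iff_separated {Δ Δbar : ℝ} (hΔ : 0 < Δ) (hΔbar : 0 < Δbar) (y : ℕ → C → ℝ) :
    S.Nice Δ Δbar y ↔ S.Separated Δ Δbar y := by
  have key : S.Valid y → ∀ t c c', S.Consecutive t c c' →
      |y t c' - y t c| = y t c' - y t c := by
    intro hv t c c' hc
    exact abs_of_pos (sub_pos.2 (hv t c c' hc.1 hc.2.1 (by rw [hc.2.2]; omega)))
  constructor
  · rintro ⟨hv, h⟩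
    exact ⟨fun t c c' hc hm => key hv t c c' hc ▸ (h t c c' hc).1 hm,
      fun t c c' hc hm => key hv t c c' hc ▸ (h t c c' hc).2 hm⟩
  · intro h
    have hv := h.valid hΔ hΔbar
    refine ⟨hv, fun t c c' hc => ?_⟩
    rw [key hv t c c' hc]
    exact ⟨h.1 t c c' hc, h.2 t c c' hc⟩

/-- The prescribed gap between the characters at positions `j` and `j + 1` of `π_t`. -/
def tightGap (Δ Δbar : ℝ) (t j : ℕ) : ℝ :=
  if ∃ d d', S.Consecutive t d d' ∧ S.pos t d = j ∧ S.SameMeeting t d d' then Δ else Δbar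

theorem exists_separated (Δ Δbar : ℝ) : ∃ y, S.Separated Δ Δbar y := by
  refine ⟨fun t c => ∑ j ∈ Finset.range (S.pos t c), S.tightGap Δ Δbar t j, ?_, ?_⟩
  · intro t c c' hc hm
    have hgap : S.tightGap Δ Δbar t (S.pos t c) = Δ := if_pos ⟨c, c', hc, rfl, hm⟩
    simp only [hc.2.2, Finset.sum_range_succ, hgap]
    ring
  · intro t c c' hc hm
    have hgap : S.tightGap Δ Δbar t (S.pos t c) = Δbar := by
      refine if_neg ?_
      rintro ⟨d, d', hd, hpos, hdm⟩
      obtain rfl : d = c := S.pos_injOn t hd.1 hc.1 hpos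
      obtain rfl : d' = c' := S.pos_injOn t hd.2.1 hc.2.1 (hd.2.2.trans hc.2.2.symm)
      exact hm hdm
    simp only [hc.2.2, Finset.sum_range_succ, hgap]
    linarith

/-- Finitely many reals can be mapped into a bounded interval without increasing distances,
keeping the order, all distances up to `M`, and a distance of at least `M` otherwise. -/
theorem exists_compression {ι : Type*} (s : Finset ι) (v : ι → ℝ) {M : ℝ} (hM : 0 ≤ M) :
    ∃ f : ℝ → ℝ, (∀ x, f x ∈ Set.Icc 0 (s.card * M)) ∧
      (∀ a b, |f a - f b| ≤ |a - b|) ∧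
      ∀ i ∈ s, ∀ b, v i ≤ b → min (b - v i) M ≤ f b - f (v i) := by
  set U : Set ℝ := ⋃ i ∈ s, Set.Icc (v i) (v i + M) with hU
  have hUmeas : MeasurableSet U := s.measurableSet_biUnion fun i _ => measurableSet_Icc
  have hUle : MeasureTheory.volume.real U ≤ s.card * M := by
    refine (MeasureTheory.measureReal_biUnion_finset_le s _).trans ?_
    simp [hM]
  have hUfin : MeasureTheory.volume U ≠ ⊤ := by
    refine ((MeasureTheory.measure_biUnion_lt_top s.finite_toSet fun i _ => ?_)).ne
    exact measure_Icc_lt_top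
  have hfin : ∀ A : Set ℝ, MeasureTheory.volume (U ∩ A) ≠ ⊤ := fun A =>
    MeasureTheory.measure_ne_top_of_subset Set.inter_subset_left hUfin
  have hdiff : ∀ a b, a ≤ b → MeasureTheory.volume.real (U ∩ Set.Iic b) -
      MeasureTheory.volume.real (U ∩ Set.Iic a) =
        MeasureTheory.volume.real (U ∩ Set.Ioc a b) := by
    intro a b hab
    rw [← Set.Iic_union_Ioc_eq_Iic hab, Set.inter_union_distrib_left,
      MeasureTheory.measureReal_union _ (hUmeas.inter measurableSet_Ioc) (hfin _) (hfin _)]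
    · ring
    · exact (Set.Iic_disjoint_Ioc le_rfl).mono Set.inter_subset_right Set.inter_subset_right
  have hlip : ∀ a b, a ≤ b → |MeasureTheory.volume.real (U ∩ Set.Iic b) -
      MeasureTheory.volume.real (U ∩ Set.Iic a)| ≤ |b - a| := by
    intro a b hab
    rw [hdiff a b hab, abs_of_nonneg MeasureTheory.measureReal_nonneg,
      abs_of_nonneg (sub_nonneg.2 hab), ← Real.volume_real_Ioc_of_le hab]
    exact MeasureTheory.measureReal_mono Set.inter_subset_right measure_Ioc_lt_top.ne
  refine ⟨fun x => MeasureTheory.volume.real (U ∩ Set.Iic x), fun x => ⟨?_, ?_⟩, ?_, ?_⟩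
  · exact MeasureTheory.measureReal_nonneg
  · exact (MeasureTheory.measureReal_mono Set.inter_subset_left hUfin).trans hUle
  · intro a b
    rcases le_total a b with hab | hab
    · rw [abs_sub_comm, abs_sub_comm a]
      exact hlip a b hab
    · exact hlip b a hab
  · intro i hi b hb
    simp only
    rw [hdiff _ _ hb]
    have hmin : 0 ≤ min (b - v i) M := le_min (sub_nonneg.2 hb) hM
    have hvol : MeasureTheory.volume.real (Set.Ioc (v i) (v i + min (b - v i) M)) =
        min (b - v i) M := by
      rw [Real.volume_real_Ioc_of_le (by linarith)]
      ring
    rw [← hvol]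
    refine MeasureTheory.measureReal_mono ?_ (hfin _)
    intro x hx
    have h₁ := min_le_left (b - v i) M
    have h₂ := min_le_right (b - v i) M
    refine ⟨?_, hx.1, by linarith [hx.2]⟩
    rw [hU]
    exact Set.mem_biUnion hi ⟨hx.1.le, by linarith [hx.2]⟩

variable {S} in
/-- Any separated coordination can be moved into a fixed box without increasing `LWH`. -/
theorem Separated.exists_mem_box {Δ Δbar : ℝ} (hΔ : 0 < Δ) (hΔbar : 0 < Δbar)
    {y : ℕ → C → ℝ} (h : S.Separated Δ Δbar y) :
    ∃ z, S.Separated Δ Δbar z ∧ S.LWH z ≤ S.LWH y ∧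
      ∀ t c, z t c ∈ Set.Icc 0
        (((S.T ×ˢ (Finset.univ : Finset C)).card : ℝ) * max Δ Δbar) := by
  obtain ⟨f, hbox, hlip, hgap⟩ := exists_compression
    (S.T ×ˢ (Finset.univ : Finset C)) (fun p => y p.1 p.2)
    (hΔ.le.trans (le_max_left Δ Δbar))
  have hgap' : ∀ t c c', S.Consecutive t c c' →
      min (y t c' - y t c) (max Δ Δbar) ≤ f (y t c') - f (y t c) := fun t c c' hc =>
    hgap (t, c) (Finset.mem_product.2 ⟨S.active_subset c hc.1, Finset.mem_univ c⟩) _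
      (h.lt_of_consecutive hΔ hΔbar hc).le
  refine ⟨fun t c => f (y t c), ⟨?_, ?_⟩, ?_, fun t c => hbox _⟩
  · intro t c c' hc hm
    have heq := h.1 t c c' hc hm
    have h₁ := hgap' t c c' hc
    rw [heq, min_eq_left (le_max_left _ _)] at h₁
    have h₂ := hlip (y t c') (y t c)
    rw [heq, abs_of_pos hΔ] at h₂
    exact le_antisymm ((le_abs_self _).trans h₂) h₁
  · intro t c c' hc hm
    exact (le_min (h.2 t c c' hc hm) (le_max_right _ _)).trans (hgap' t c c' hc)
  · exact Finset.sum_le_sum fun t _ => Finset.sum_le_sum fun c _ => hlip _ _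

theorem isClosed_separated (Δ Δbar : ℝ) : IsClosed {y | S.Separated Δ Δbar y} := by
  simp only [Separated, Set.ofPred_and, Set.ofPred_forall]
  refine IsClosed.inter ?_ ?_
  · refine isClosed_iInter fun t => isClosed_iInter fun c => isClosed_iInter fun c' =>
      isClosed_iInter fun _ => isClosed_iInter fun _ => ?_
    exact isClosed_eq (by fun_prop) (by fun_prop)
  · refine isClosed_iInter fun t => isClosed_iInter fun c => isClosed_iInter fun c' =>
      isClosed_iInter fun _ => isClosed_iInter fun _ => ?_
    exact isClosed_le (by fun_prop) (by fun_prop)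

theorem continuous_LWH : Continuous S.LWH := by
  unfold LWH
  fun_prop

/-- `LWH` attains its minimum over separated coordinations at a nonnegative one. -/
theorem exists_separated_min_LWH {Δ Δbar : ℝ} (hΔ : 0 < Δ) (hΔbar : 0 < Δbar) :
    ∃ y, S.Separated Δ Δbar y ∧ (∀ t c, 0 ≤ y t c) ∧
      ∀ z, S.Separated Δ Δbar z → S.LWH y ≤ S.LWH z := by
  set B : ℝ := ((S.T ×ˢ (Finset.univ : Finset C)).card : ℝ) * max Δ Δbar
  have hbox : IsCompact {y : ℕ → C → ℝ | ∀ t c, y t c ∈ Set.Icc 0 B} := by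
    have := isCompact_univ_pi fun _ : ℕ =>
      isCompact_univ_pi fun _ : C => isCompact_Icc (a := (0 : ℝ)) (b := B)
    simpa only [Set.pi, Set.mem_univ, true_imp_iff, Set.mem_ofPred_eq] using this
  have hcomp := hbox.inter_right (S.isClosed_separated Δ Δbar)
  obtain ⟨y₀, hy₀⟩ := S.exists_separated Δ Δbar
  obtain ⟨z₀, hz₀, -, hz₀box⟩ := hy₀.exists_mem_box hΔ hΔbar
  obtain ⟨y, hy, hmin⟩ := hcomp.exists_isMinOn ⟨z₀, hz₀box, hz₀⟩ S.continuous_LWH.continuousOn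
  refine ⟨y, hy.2, fun t c => (hy.1 t c).1, fun z hz => ?_⟩
  obtain ⟨z', hz', hle, hz'box⟩ := hz.exists_mem_box hΔ hΔbar
  exact (hmin ⟨hz'box, hz'⟩).trans hle

variable {S} in
theorem InPolytope.LWH_le_sumW {Δ Δbar : ℝ} {y w : ℕ → C → ℝ}
    (h : S.InPolytope Δ Δbar y w) : S.LWH y ≤ S.sumW w := by
  refine Finset.sum_le_sum fun t ht => Finset.sum_le_sum fun c hc => ?_
  rw [Finset.mem_Icc] at ht
  simp only [Ac, Finset.mem_inter, Finset.mem_filter, Finset.mem_univ, true_and] at hc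
  obtain ⟨h₁, h₂⟩ := h.2.2.1 t c ht.1 (by omega) hc.1 hc.2
  exact abs_le.2 ⟨by linarith, h₁⟩

/-- For reals `Δ > 0`, `Δ̄ > 0`: the minimum of the LP objective over the wiggle-height
polytope is attained and equals the minimum of `LWH` over `(Δ, Δ̄)`-nice coordinations,
which is also attained. -/
theorem lp_min_eq_lwhMin (Δ Δbar : ℝ) (hΔ : 0 < Δ) (hΔbar : 0 < Δbar) :
    ∃ v : ℝ,
      IsLeast {v : ℝ | ∃ y w, S.InPolytope Δ Δbar y w ∧ S.sumW w = v} v ∧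
      IsLeast {v : ℝ | ∃ y, S.Nice Δ Δbar y ∧ S.LWH y = v} v := by
  obtain ⟨y, hy, hnonneg, hmin⟩ := S.exists_separated_min_LWH hΔ hΔbar
  refine ⟨S.LWH y, ⟨⟨y, fun t c => |y t c - y (t + 1) c|, ?_, rfl⟩, ?_⟩, ⟨⟨y, ?_, rfl⟩, ?_⟩⟩
  · refine ⟨hy.1, hy.2, fun t c _ _ _ _ => ⟨le_abs_self _, ?_⟩, fun t c _ => hnonneg t c⟩
    exact (le_abs_self _).trans_eq (abs_sub_comm _ _)
  · rintro _ ⟨z, w, hzw, rfl⟩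
    exact (hmin z ⟨hzw.1, hzw.2.1⟩).trans hzw.LWH_le_sumW
  · exact (S.nice_iff_separated hΔ hΔbar y).2 hy
  · rintro _ ⟨z, hz, rfl⟩
    exact hmin z ((S.nice_iff_separated hΔ hΔbar z).1 hz)

end Storyline
end
end

section
/- Let dy, r, dx, oc be real numbers with dy > 0, r > 0, dx ≥ 0, oc > 0 and oc ≤ 2r. If oc² = dx² + dy² and 2r·dx = oc·√(4r² − oc²), then dx² = 2r·dy − dy². -/
/-- The algebraic relation for wiggle geometry: if `oc² = dx² + dy²` and
`2·r·dx = oc·√(4·r² - oc²)`, with `dy > 0`, `r > 0`, `dx ≥ 0`, `0 < oc ≤ 2r`, then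
`dx² = 2·r·dy - dy²`. -/
theorem wiggle_geometry (dy r dx oc : ℝ) (hdy : 0 < dy) (hr : 0 < r) (hdx : 0 ≤ dx)
    (hoc : 0 < oc) (hoc2 : oc ≤ 2 * r)
    (h1 : oc ^ 2 = dx ^ 2 + dy ^ 2)
    (h2 : 2 * r * dx = oc * Real.sqrt (4 * r ^ 2 - oc ^ 2)) :
    dx ^ 2 = 2 * r * dy - dy ^ 2 := by
  have hnonneg : 0 ≤ 4 * r ^ 2 - oc ^ 2 := by nlinarith
  have hsq : (2 * r * dx) ^ 2 = oc ^ 2 * (4 * r ^ 2 - oc ^ 2) := by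
    rw [h2, mul_pow, Real.sq_sqrt hnonneg]
  have hquartic : (oc ^ 2) ^ 2 = (2 * r * dy) ^ 2 := by
    linear_combination 4 * r ^ 2 * h1 + hsq
  have hchord : oc ^ 2 = 2 * r * dy :=
    (pow_left_inj₀ (by positivity) (by positivity) two_ne_zero).mp hquartic
  linarith
end
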